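/- Let q be a prime power, ψ : 𝔽_q → ℂ a nontrivial additive character, β a composition of N with ℓ parts, and P a normal subposet of the chain on {1,…,ℓ}. For all Y, Y' ∈ 𝔲𝔱_{fat_β(P)}: (1/|UT_{fat_β(P)}|) · Σ_{u ∈ UT_{fat_β(P)}} χ^Y(u) · conj(χ^{Y'}(u)) equals |O(Y)| if Y' ∈ O(Y), and equals 0 otherwise (the supercharacters are orthogonal with ⟨χ^Y, χ^Y⟩ = χ^Y(1) = |O(Y)|). -/

import Mathlib

open scoped Classical

noncomputable section

/-- A subposet of the chain `0 < 1 < ⋯ < l-1`: a transitive relation contained in `<`. -/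
def IsChainSubposet {l : ℕ} (P : Fin l → Fin l → Prop) : Prop :=
  (∀ i j k, P i j → P j k → P i k) ∧ ∀ i j, P i j → i < j

/-- A normal subposet of the chain. -/
def IsNormalChainSubposet {l : ℕ} (P : Fin l → Fin l → Prop) : Prop :=
  IsChainSubposet P ∧ (∀ i j k, P j k → i < j → P i k) ∧ ∀ j k m, P j k → k < m → P j m

/-- The relation `fat_β(P)` on `Fin N` obtained from a relation `P` on block indices. -/
def fatR {N l : ℕ} (blk : Fin N → Fin l) (P : Fin l → Fin l → Prop) :
    Fin N → Fin N → Prop := fun r s => P (blk r) (blk s)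

/-- The "pattern group" of a relation: unipotent matrices supported on the relation. -/
def UTgrp (F : Type) [Field F] {N : ℕ} (R : Fin N → Fin N → Prop) :
    Set (Matrix (Fin N) (Fin N) F) :=
  {g | (∀ r, g r r = 1) ∧ ∀ r s, r ≠ s → ¬ R r s → g r s = 0}

/-- The nilpotent "pattern algebra" of a relation. -/
def utAlg (F : Type) [Field F] {N : ℕ} (R : Fin N → Fin N → Prop) :
    Set (Matrix (Fin N) (Fin N) F) :=
  {x | ∀ r s, ¬ R r s → x r s = 0}

/-- The parabolic subgroup `P_β`: invertible block upper-triangular matrices. -/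
def parab (F : Type) [Field F] {N l : ℕ} (blk : Fin N → Fin l) :
    Set (Matrix (Fin N) (Fin N) F) :=
  {g | IsUnit g ∧ ∀ r s, ¬ blk r ≤ blk s → g r s = 0}

/-- The Levi subgroup `L_β`: invertible block diagonal matrices. -/
def levi (F : Type) [Field F] {N l : ℕ} (blk : Fin N → Fin l) :
    Set (Matrix (Fin N) (Fin N) F) :=
  {g | IsUnit g ∧ ∀ r s, blk r ≠ blk s → g r s = 0}

/-- The opposite unipotent radical `U⁻_β`: block lower uni-triangular matrices. -/
def uminus (F : Type) [Field F] {N l : ℕ} (blk : Fin N → Fin l) :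
    Set (Matrix (Fin N) (Fin N) F) :=
  {g | (∀ r, g r r = 1) ∧ ∀ r s, r ≠ s → ¬ blk s < blk r → g r s = 0}

/-- Truncation of a matrix to the positions of a relation. -/
def trunc {F : Type} [Field F] {N : ℕ} (R : Fin N → Fin N → Prop)
    (x : Matrix (Fin N) (Fin N) F) : Matrix (Fin N) (Fin N) F :=
  fun r s => if R r s then x r s else 0

/-- The two-sided orbit `O(Y)` of `Y` under the block lower-triangular invertible
matrices, truncated back to the positions of `R`. -/
def orb (F : Type) [Field F] {N l : ℕ} (blk : Fin N → Fin l) (R : Fin N → Fin N → Prop)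
    (Y : Matrix (Fin N) (Fin N) F) : Set (Matrix (Fin N) (Fin N) F) :=
  {Z | ∃ g h : Matrix (Fin N) (Fin N) F, IsUnit g ∧ IsUnit h ∧
      (∀ r s, blk r < blk s → g r s = 0) ∧ (∀ r s, blk r < blk s → h r s = 0) ∧
      Z = trunc R (g * Y * h)}

/-- The supercharacter `χ^Y` as a function on matrices. -/
def chi {F : Type} [Field F] [Fintype F] (ψ : F → ℂ) {N l : ℕ} (blk : Fin N → Fin l)
    (R : Fin N → Fin N → Prop) (Y u : Matrix (Fin N) (Fin N) F) : ℂ :=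
  ∑ᶠ Z ∈ orb F blk R Y, ψ (∑ r, ∑ s, Z r s * (u - 1) r s)

/-- A partial permutation matrix: 0-1 entries, at most one 1 in each row and column. -/
def IsPPM {F : Type} [Field F] {N : ℕ} (x : Matrix (Fin N) (Fin N) F) : Prop :=
  (∀ r s, x r s = 0 ∨ x r s = 1) ∧
  (∀ r s t, x r s ≠ 0 → x r t ≠ 0 → s = t) ∧
  (∀ r s t, x r t ≠ 0 → x s t ≠ 0 → r = s)

/-- The rank of the block of `x` with rows in block `i` and columns in block `j`. -/
def blockRank {F : Type} [Field F] {N l : ℕ} (blk : Fin N → Fin l)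
    (x : Matrix (Fin N) (Fin N) F) (i j : Fin l) : ℕ :=
  (x.submatrix (fun r : {r : Fin N // blk r = i} => (r : Fin N))
    (fun s : {s : Fin N // blk s = j} => (s : Fin N))).rank

end

theorem aux_trunc {F : Type} [Field F] {N l : ℕ} (blk : Fin N → Fin l)
    (P : Fin l → Fin l → Prop) (hP : IsNormalChainSubposet P)
    (g h A : Matrix (Fin N) (Fin N) F)
    (hg : ∀ r s, blk r < blk s → g r s = 0) (hh : ∀ r s, blk r < blk s → h r s = 0) :
    trunc (fatR blk P) (g * trunc (fatR blk P) A * h) = trunc (fatR blk P) (g * A * h) := by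
  have ht : ∀ (B : Matrix (Fin N) (Fin N) F) i j,
      trunc (fatR blk P) B i j = if fatR blk P i j then B i j else 0 := fun _ _ _ => rfl
  ext r s
  rw [ht, ht]
  split_ifs with hR
  · rw [Matrix.mul_apply, Matrix.mul_apply]
    refine Finset.sum_congr rfl fun b _ => ?_
    by_cases hb : blk b < blk s
    · rw [hh b s hb]; simp
    refine congrArg (fun t => t * h b s) ?_
    rw [Matrix.mul_apply, Matrix.mul_apply]
    refine Finset.sum_congr rfl fun a _ => ?_
    by_cases ha : blk r < blk a
    · rw [hg r a ha]; simp
    have : fatR blk P a b := by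
      unfold fatR at hR ⊢
      have h1 : P (blk a) (blk s) := by
        rcases lt_or_eq_of_le (not_lt.mp ha) with h1 | h1
        · exact hP.2.1 _ _ _ hR h1
        · rw [h1]; exact hR
      rcases lt_or_eq_of_le (not_lt.mp hb) with h2 | h2
      · exact hP.2.2 _ _ _ h1 h2
      · rw [← h2]; exact h1
    rw [ht, if_pos this]
  · rfl

theorem aux_mul {F : Type} [Field F] {N l : ℕ} (blk : Fin N → Fin l)
    (g h : Matrix (Fin N) (Fin N) F)
    (hg : ∀ r s, blk r < blk s → g r s = 0) (hh : ∀ r s, blk r < blk s → h r s = 0) :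
    ∀ r s, blk r < blk s → (g * h) r s = 0 := by
  intro r s hrs
  rw [Matrix.mul_apply]
  refine Finset.sum_eq_zero fun a _ => ?_
  by_cases ha : blk r < blk a
  · rw [hg r a ha, zero_mul]
  · rw [hh a s (lt_of_le_of_lt (not_lt.mp ha) hrs), mul_zero]

theorem aux_inv {F : Type} [Field F] {N l : ℕ} (blk : Fin N → Fin l)
    (g : Matrix (Fin N) (Fin N) F) (hu : IsUnit g)
    (hg : ∀ r s, blk r < blk s → g r s = 0) :
    ∃ k : Matrix (Fin N) (Fin N) F, IsUnit k ∧ k * g = 1 ∧ g * k = 1 ∧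
      ∀ r s, blk r < blk s → k r s = 0 := by
  have hd : IsUnit g.det := (Matrix.isUnit_iff_isUnit_det g).mp hu
  have : Invertible g := hu.invertible
  have hT : g.BlockTriangular (OrderDual.toDual ∘ blk) := fun i j hij => hg i j hij
  have hT' := Matrix.blockTriangular_inv_of_blockTriangular hT
  refine ⟨g⁻¹, ?_, Matrix.nonsing_inv_mul g hd, Matrix.mul_nonsing_inv g hd, fun r s hrs => hT' hrs⟩
  exact (Matrix.isUnit_nonsing_inv_iff).mpr hu

theorem aux_symm {F : Type} [Field F] {N l : ℕ} (blk : Fin N → Fin l)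
    (P : Fin l → Fin l → Prop) (hP : IsNormalChainSubposet P)
    (Y Z : Matrix (Fin N) (Fin N) F) (hY : Y ∈ utAlg F (fatR blk P))
    (hZ : Z ∈ orb F blk (fatR blk P) Y) : Y ∈ orb F blk (fatR blk P) Z := by
  obtain ⟨g, h, hgu, hhu, hg, hh, rfl⟩ := hZ
  obtain ⟨k, hku, hkg, -, hk⟩ := aux_inv blk g hgu hg
  obtain ⟨m, hmu, -, hhm, hm⟩ := aux_inv blk h hhu hh
  refine ⟨k, m, hku, hmu, hk, hm, ?_⟩
  rw [aux_trunc blk P hP _ _ _ hk hm]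
  have : k * (g * Y * h) * m = Y := by
    calc k * (g * Y * h) * m = (k * g) * Y * (h * m) := by simp only [Matrix.mul_assoc]
      _ = Y := by rw [hkg, hhm, Matrix.one_mul, Matrix.mul_one]
  rw [this]
  ext r s
  unfold trunc
  split_ifs with hR
  · rfl
  · exact hY r s hR

theorem aux_trans {F : Type} [Field F] {N l : ℕ} (blk : Fin N → Fin l)
    (P : Fin l → Fin l → Prop) (hP : IsNormalChainSubposet P)
    (Y Z W : Matrix (Fin N) (Fin N) F)
    (hZ : Z ∈ orb F blk (fatR blk P) Y) (hW : W ∈ orb F blk (fatR blk P) Z) :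
    W ∈ orb F blk (fatR blk P) Y := by
  obtain ⟨g, h, hgu, hhu, hg, hh, rfl⟩ := hZ
  obtain ⟨k, m, hku, hmu, hk, hm, rfl⟩ := hW
  refine ⟨k * g, h * m, hku.mul hgu, hhu.mul hmu, aux_mul blk _ _ hk hg, aux_mul blk _ _ hh hm, ?_⟩
  rw [aux_trunc blk P hP _ _ _ hk hm]
  simp only [Matrix.mul_assoc]

theorem aux_mem {F : Type} [Field F] {N l : ℕ} (blk : Fin N → Fin l)
    (R : Fin N → Fin N → Prop) (Y Z : Matrix (Fin N) (Fin N) F)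
    (hZ : Z ∈ orb F blk R Y) : Z ∈ utAlg F R := by
  obtain ⟨g, h, -, -, -, -, rfl⟩ := hZ
  intro r s hR
  simp [trunc, hR]

/-- Orthogonality of the linear characters. -/
theorem aux_sum (F : Type) [Field F] [Fintype F] (ψ : AddChar F ℂ) (hψ : ∃ a, ψ a ≠ 1)
    {N : ℕ} (R : Fin N → Fin N → Prop) (hR : ∀ r s, R r s → r ≠ s)
    (Z W : Matrix (Fin N) (Fin N) F) (hZ : Z ∈ utAlg F R) (hW : W ∈ utAlg F R) :
    ∑ u ∈ (UTgrp F R).toFinset, ψ (∑ r, ∑ s, Z r s * (u - 1) r s) *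
      (starRingEnd ℂ) (ψ (∑ r, ∑ s, W r s * (u - 1) r s)) =
    if Z = W then ((UTgrp F R).toFinset.card : ℂ) else 0 := by
  have key : ∀ u : Matrix (Fin N) (Fin N) F, ψ (∑ r, ∑ s, Z r s * (u - 1) r s) *
      (starRingEnd ℂ) (ψ (∑ r, ∑ s, W r s * (u - 1) r s)) =
      ψ (∑ r, ∑ s, (Z - W) r s * (u - 1) r s) := by
    intro u
    rw [← AddChar.map_neg_eq_conj, ← AddChar.map_add_eq_mul]
    congr 1
    simp only [Matrix.sub_apply, sub_mul, Finset.sum_sub_distrib]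
    ring
  simp only [key]
  split_ifs with h
  · subst h
    simp
  · have : ∃ r s, Z r s ≠ W r s := by
      by_contra! hc
      exact h (Matrix.ext hc)
    obtain ⟨r, s, hrs⟩ := this
    have hRrs : R r s := by
      by_contra hn
      exact hrs (by rw [hZ r s hn, hW r s hn])
    obtain ⟨a, ha⟩ := hψ
    set c : F := a / (Z r s - W r s) with hc
    have hD : Z r s - W r s ≠ 0 := sub_ne_zero.mpr hrs
    have hmem : ∀ (t : F) (u : Matrix (Fin N) (Fin N) F), u ∈ UTgrp F R →
        u + Matrix.single r s t ∈ UTgrp F R := by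
      intro t u hu
      refine ⟨fun i => ?_, fun i j hij hn => ?_⟩
      · rw [Matrix.add_apply, hu.1 i, Matrix.single_apply_of_ne, add_zero]
        rintro ⟨rfl, h2⟩
        exact hR _ _ hRrs h2.symm
      · rw [Matrix.add_apply, hu.2 i j hij hn, Matrix.single_apply_of_ne, add_zero]
        rintro ⟨rfl, rfl⟩
        exact hn hRrs
    have hS : ∑ u ∈ (UTgrp F R).toFinset, ψ (∑ r, ∑ s, (Z - W) r s * (u - 1) r s) =
        ψ a * ∑ u ∈ (UTgrp F R).toFinset, ψ (∑ r, ∑ s, (Z - W) r s * (u - 1) r s) := by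
      rw [Finset.mul_sum]
      symm
      refine Finset.sum_bij' (fun u _ => u + Matrix.single r s c)
        (fun u _ => u + Matrix.single r s (-c)) ?_ ?_ ?_ ?_ ?_
      · intro u hu
        simpa using hmem c u (by simpa using hu)
      · intro u hu
        simpa using hmem (-c) u (by simpa using hu)
      · intro u _
        simp [add_assoc, ← Matrix.single_add]
      · intro u _
        simp [add_assoc, ← Matrix.single_add]
      · intro u _
        rw [← AddChar.map_add_eq_mul]
        congr 1
        have e : ∀ i j, (Z - W) i j * (u + Matrix.single r s c - 1) i j =
            (Z - W) i j * (Matrix.single r s c) i j + (Z - W) i j * (u - 1) i j := by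
          intro i j
          simp only [Matrix.sub_apply, Matrix.add_apply]
          ring
        simp only [e, Finset.sum_add_distrib]
        congr 1
        rw [Finset.sum_eq_single r, Finset.sum_eq_single s]
        · rw [Matrix.single_apply_same, hc, Matrix.sub_apply]
          field_simp
        · intro j _ hj
          rw [Matrix.single_apply_of_ne, mul_zero]
          rintro ⟨-, h2⟩; exact hj h2.symm
        · simp
        · intro i _ hi
          refine Finset.sum_eq_zero fun j _ => ?_
          rw [Matrix.single_apply_of_ne, mul_zero]
          rintro ⟨h2, -⟩; exact hi h2.symm
        · simp
    have : (ψ a - 1) * ∑ u ∈ (UTgrp F R).toFinset, ψ (∑ r, ∑ s, (Z - W) r s * (u - 1) r s) = 0 := by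
      rw [sub_mul, ← hS]; ring
    exact (mul_eq_zero.mp this).resolve_left (sub_ne_zero.mpr ha)

/-- orthogonality of supercharacters.  With `𝔽_q`, `ψ` nontrivial, a
composition `β` of `N` and `P` a normal subposet of the chain on `{1,…,ℓ}`, for all
`Y, Y' ∈ 𝔲𝔱_{fat_β(P)}`, the normalized inner product
`(1/|UT|) Σ_{u ∈ UT} χ^Y(u) conj(χ^{Y'}(u))` equals `|O(Y)|` if `Y' ∈ O(Y)` and `0`
otherwise. -/
theorem stmt_6 (F : Type) [Field F] [Fintype F] (ψ : F → ℂ)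
    (hψadd : ∀ a b, ψ (a + b) = ψ a * ψ b) (hψ0 : ψ 0 = 1) (hψnt : ∃ a, ψ a ≠ 1)
    (N l : ℕ) (β : Fin l → ℕ) (blk : Fin N → Fin l)
    (hβ : ∀ i, 0 < β i) (hblk : Monotone blk)
    (hcard : ∀ i, (Finset.univ.filter fun r => blk r = i).card = β i)
    (P : Fin l → Fin l → Prop) (hP : IsNormalChainSubposet P)
    (Y Y' : Matrix (Fin N) (Fin N) F)
    (hY : Y ∈ utAlg F (fatR blk P)) (hY' : Y' ∈ utAlg F (fatR blk P)) :
    (1 / (Set.ncard (UTgrp F (fatR blk P)) : ℂ)) *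
        ∑ᶠ u ∈ UTgrp F (fatR blk P),
          chi ψ blk (fatR blk P) Y u * (starRingEnd ℂ) (chi ψ blk (fatR blk P) Y' u) =
      if Y' ∈ orb F blk (fatR blk P) Y then (Set.ncard (orb F blk (fatR blk P) Y) : ℂ)
      else 0 := by
  set Ψ : AddChar F ℂ := ⟨ψ, hψ0, hψadd⟩ with hΨ
  have hΨψ : ∀ a, ψ a = Ψ a := fun _ => rfl
  have hR : ∀ r s, fatR blk P r s → r ≠ s := by
    rintro r s h rfl
    exact lt_irrefl _ (hP.1.2 _ _ h)
  set R := fatR blk P with hRdef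
  have hfin : ∀ (S : Set (Matrix (Fin N) (Fin N) F)) (f : Matrix (Fin N) (Fin N) F → ℂ),
      ∑ᶠ u ∈ S, f u = ∑ u ∈ S.toFinset, f u := by
    intro S f
    exact finsum_mem_eq_toFinset_sum f S
  have hne : ((UTgrp F R).toFinset.card : ℂ) ≠ 0 := by
    rw [Nat.cast_ne_zero]
    refine Finset.card_ne_zero_of_mem (a := 1) ?_
    rw [Set.mem_toFinset]
    exact ⟨fun r => Matrix.one_apply_eq r, fun r s h _ => Matrix.one_apply_ne h⟩
  have hmain : ∑ᶠ u ∈ UTgrp F R, chi ψ blk R Y u * (starRingEnd ℂ) (chi ψ blk R Y' u) =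
      ((UTgrp F R).toFinset.card : ℂ) *
        (((orb F blk R Y).toFinset ∩ (orb F blk R Y').toFinset).card : ℂ) := by
    rw [hfin]
    simp only [chi, hfin, map_sum, Finset.sum_mul_sum, hΨψ]
    rw [Finset.sum_comm]
    have : ∀ Z ∈ (orb F blk R Y).toFinset,
        ∑ u ∈ (UTgrp F R).toFinset, ∑ W ∈ (orb F blk R Y').toFinset,
          Ψ (∑ r, ∑ s, Z r s * (u - 1) r s) *
            (starRingEnd ℂ) (Ψ (∑ r, ∑ s, W r s * (u - 1) r s)) =
        if Z ∈ (orb F blk R Y').toFinset then ((UTgrp F R).toFinset.card : ℂ) else 0 := by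
      intro Z hZ
      rw [Finset.sum_comm]
      rw [Finset.sum_congr rfl fun W hW => aux_sum F Ψ hψnt R hR Z W
        (aux_mem blk R Y Z (by simpa using hZ)) (aux_mem blk R Y' W (by simpa using hW))]
      rw [Finset.sum_ite_eq]
    rw [Finset.sum_congr rfl this, ← Finset.sum_filter, Finset.sum_const,
      Finset.filter_mem_eq_inter, nsmul_eq_mul, mul_comm]
  rw [hmain, Set.ncard_eq_toFinset_card', Set.ncard_eq_toFinset_card', one_div,
    inv_mul_cancel_left₀ hne]
  split_ifs with h
  · congr 2
    ext Z
    simp only [Finset.mem_inter, Set.mem_toFinset, and_iff_left_iff_imp]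
    intro hZ
    exact aux_trans blk P hP _ _ _ (aux_symm blk P hP _ _ hY h) hZ
  · rw [Nat.cast_eq_zero, Finset.card_eq_zero, Finset.eq_empty_iff_forall_notMem]
    intro Z hZ
    simp only [Finset.mem_inter, Set.mem_toFinset] at hZ
    exact h (aux_trans blk P hP _ _ _ hZ.1 (aux_symm blk P hP _ _ hY' hZ.2))
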